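/- Let G be a simple graph on n vertices, let e be an edge of G and H = G − e, with H having at least two positive and at least two negative eigenvalues, and let θ_1 ≥ ⋯ ≥ θ_n denote the eigenvalues of the adjacency matrix of H. If s^+(H) + max{θ_2 − 1, 0}^2 − θ_2^2 ≥ n − 1 and s^-(H) + max{−θ_n − 1, 0}^2 − θ_n^2 ≥ n − 1, then min{s^+(G), s^-(G)} ≥ n − 1. -/

import Mathlib

open Polynomial

/-- Adjacency matrix of a simple graph over ℝ (using classical decidability). -/
noncomputable def adjMat {V : Type*} [Fintype V] (G : SimpleGraph V) : Matrix V V ℝ :=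
  letI := Classical.decRel G.Adj
  SimpleGraph.adjMatrix ℝ G

/-- Positive square energy: the sum of the squares of the positive adjacency eigenvalues. -/
noncomputable def sPlus {V : Type*} [Fintype V] [DecidableEq V] (G : SimpleGraph V) : ℝ :=
  (((adjMat G).charpoly.roots.filter (fun x : ℝ => 0 < x)).map (fun x : ℝ => x ^ 2)).sum

/-- Negative square energy: the sum of the squares of the negative adjacency eigenvalues. -/
noncomputable def sMinus {V : Type*} [Fintype V] [DecidableEq V] (G : SimpleGraph V) : ℝ :=
  (((adjMat G).charpoly.roots.filter (fun x : ℝ => x < 0)).map (fun x : ℝ => x ^ 2)).sum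

/-- squared positive part -/
noncomputable def fpos (x : ℝ) : ℝ := max x 0 ^ 2

lemma fpos_mono {x y : ℝ} (h : x ≤ y) : fpos x ≤ fpos y := by
  unfold fpos
  have := max_le_max_right 0 h
  have h0 := le_max_right x 0
  gcongr

lemma fpos_incr {x y d : ℝ} (h : y ≤ x) (hd : 0 ≤ d) :
    fpos y - fpos (y - d) ≤ fpos x - fpos (x - d) := by
  unfold fpos
  rcases max_cases y 0 with ⟨h1, h1'⟩ | ⟨h1, h1'⟩ <;>
  rcases max_cases x 0 with ⟨h2, h2'⟩ | ⟨h2, h2'⟩ <;>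
  rcases max_cases (y - d) 0 with ⟨h3, h3'⟩ | ⟨h3, h3'⟩ <;>
  rcases max_cases (x - d) 0 with ⟨h4, h4'⟩ | ⟨h4, h4'⟩ <;>
  rw [h1, h2, h3, h4] <;> nlinarith [mul_nonneg hd (sub_nonneg.2 h)]

lemma real_aux (a m : ℕ → ℝ) (k n : ℕ) 
    (h1 : ∀ i, i < n → m i ≤ a i) (h2 : ∀ i, i + 1 < n → a (i + 1) ≤ m i)
    (j : ℕ) (hkj : k ≤ j) (hj : j < n) :
    (∑ i ∈ Finset.Ico k (j + 1), (fpos (a i) - fpos (m i)) ≤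
      fpos (a k) - fpos (a k - ∑ i ∈ Finset.Ico k (j + 1), (a i - m i))) ∧
    (j + 1 < n → ∑ i ∈ Finset.Ico k (j + 1), (a i - m i) ≤ a k - a (j + 1)) := by
  induction j, hkj using Nat.le_induction with
  | base =>
    simp only [Nat.Ico_succ_singleton, Finset.sum_singleton]
    refine ⟨by simp, fun h => ?_⟩
    linarith [h2 k h]
  | succ j hkj ih =>
    obtain ⟨i1, i2⟩ := ih (by omega)
    have i2 := i2 hj
    rw [Finset.sum_Ico_succ_top (by omega), Finset.sum_Ico_succ_top (by omega : k ≤ j + 1)]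
    set D := ∑ i ∈ Finset.Ico k (j + 1), (a i - m i)
    constructor
    · have := @fpos_incr (a k - D) (a (j+1)) (a (j+1) - m (j+1)) (by linarith)
        (by linarith [h1 _ hj])
      rw [sub_sub_cancel] at this
      rw [← sub_sub]
      linarith
    · intro h
      linarith [h2 _ h]

lemma real_main (a m b : ℕ → ℝ) (k n : ℕ) (hkn : k < n) 
    (h1 : ∀ i, i < n → m i ≤ a i) (h2 : ∀ i, i + 1 < n → a (i + 1) ≤ m i)
    (h3 : ∀ i, i < n → m i ≤ b i)
    (hs : ∑ i ∈ Finset.range n, m i = ∑ i ∈ Finset.range n, a i - 1) :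
    ∑ i ∈ Finset.Ico k n, fpos (a i) - fpos (a k) + fpos (a k - 1) ≤
      ∑ i ∈ Finset.Ico k n, fpos (b i) := by
  obtain ⟨h, -⟩ := real_aux a m k n h1 h2 (n - 1) (by omega) (by omega)
  rw [Nat.sub_add_cancel (by omega)] at h
  rw [Finset.sum_sub_distrib] at h
  have hb : ∑ i ∈ Finset.Ico k n, fpos (m i) ≤ ∑ i ∈ Finset.Ico k n, fpos (b i) :=
    Finset.sum_le_sum fun i hi => fpos_mono (h3 i (Finset.mem_Ico.1 hi).2)
  have hD : ∑ i ∈ Finset.Ico k n, (a i - m i) ≤ 1 := by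
    have : ∑ i ∈ Finset.Ico k n, (a i - m i) ≤ ∑ i ∈ Finset.range n, (a i - m i) := by
      refine Finset.sum_le_sum_of_subset_of_nonneg ?_ ?_
      · intro i hi
        simp only [Finset.mem_Ico, Finset.mem_range] at *
        exact hi.2
      · intro i hi _
        linarith [h1 i (Finset.mem_range.1 hi)]
    have h5 : ∑ i ∈ Finset.range n, (a i - m i) = 1 := by
      rw [Finset.sum_sub_distrib, hs]; ring
    linarith
  have := @fpos_mono (a k - 1) (a k - ∑ i ∈ Finset.Ico k n, (a i - m i)) (by linarith)
  linarith

open Matrix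

/-- spectral data of a symmetric matrix -/
structure SD {n : ℕ} (A : Matrix (Fin n) (Fin n) ℝ) (a : ℕ → ℝ) (u : Fin n → Fin n → ℝ) :
    Prop where
  anti : ∀ i j, i ≤ j → j < n → a j ≤ a i
  nrm : ∀ x : Fin n → ℝ, x ⬝ᵥ x = ∑ i, (u i ⬝ᵥ x) ^ 2
  quad : ∀ x : Fin n → ℝ, x ⬝ᵥ (A *ᵥ x) = ∑ i : Fin n, a i * (u i ⬝ᵥ x) ^ 2
  tr : A.trace = ∑ i ∈ Finset.range n, a i

lemma exists_ker {n : ℕ} {ι : Type} [Fintype ι] (c : ι → Fin n → ℝ) (h : Fintype.card ι < n) :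
    ∃ x : Fin n → ℝ, x ≠ 0 ∧ ∀ k, c k ⬝ᵥ x = 0 := by
  have := LinearMap.ker_ne_bot_of_finrank_lt (f := Matrix.mulVecLin (Matrix.of c)) (by simpa using h)
  obtain ⟨x, hx, hx0⟩ := Submodule.exists_mem_ne_zero_of_ne_bot this
  refine ⟨x, hx0, fun k => ?_⟩
  have := congrFun (LinearMap.mem_ker.1 hx) k
  simpa [Matrix.mulVec] using this

lemma dot_pos {n : ℕ} {x : Fin n → ℝ} (h : x ≠ 0) : 0 < x ⬝ᵥ x := by
  have h0 : 0 ≤ x ⬝ᵥ x := Finset.sum_nonneg fun i _ => mul_self_nonneg _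
  refine lt_of_le_of_ne h0 fun h1 => h (dotProduct_self_eq_zero.1 h1.symm)

lemma SD.ge {n : ℕ} {A : Matrix (Fin n) (Fin n) ℝ} {a : ℕ → ℝ} {u} (h : SD A a u) (i : ℕ)
    (x : Fin n → ℝ) (hi : i < n) (hx : ∀ j : Fin n, i < j → u j ⬝ᵥ x = 0) :
    a i * (x ⬝ᵥ x) ≤ x ⬝ᵥ (A *ᵥ x) := by
  rw [h.nrm, h.quad, Finset.mul_sum]
  refine Finset.sum_le_sum fun j _ => ?_
  by_cases hj : i < j
  · simp [hx j hj]
  · exact mul_le_mul_of_nonneg_right (h.anti _ _ (by omega) hi) (sq_nonneg _)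

lemma SD.le {n : ℕ} {A : Matrix (Fin n) (Fin n) ℝ} {a : ℕ → ℝ} {u} (h : SD A a u) (i : ℕ)
    (x : Fin n → ℝ) (hx : ∀ j : Fin n, (j : ℕ) < i → u j ⬝ᵥ x = 0) :
    x ⬝ᵥ (A *ᵥ x) ≤ a i * (x ⬝ᵥ x) := by
  rw [h.nrm, h.quad, Finset.mul_sum]
  refine Finset.sum_le_sum fun j _ => ?_
  by_cases hj : (j : ℕ) < i
  · simp [hx j hj]
  · exact mul_le_mul_of_nonneg_right (h.anti _ _ (by omega) j.2) (sq_nonneg _)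

lemma interlace {n : ℕ} {A B : Matrix (Fin n) (Fin n) ℝ} {a b : ℕ → ℝ} {u v}
    (hA : SD A a u) (hB : SD B b v) (r : ℕ) (w : Fin r → Fin n → ℝ)
    (hq : ∀ x, (∀ k, w k ⬝ᵥ x = 0) → x ⬝ᵥ (A *ᵥ x) ≤ x ⬝ᵥ (B *ᵥ x))
    (i : ℕ) (hi : i + r < n) : a (i + r) ≤ b i := by
  let c : (Fin (n - 1 - (i + r)) ⊕ (Fin i ⊕ Fin r)) → Fin n → ℝ :=
    Sum.elim (fun j => u ⟨i + r + 1 + j, by omega⟩)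
      (Sum.elim (fun j => v ⟨j, by omega⟩) w)
  obtain ⟨x, hx0, hx⟩ := exists_ker c (by simp; omega)
  have h1 := hA.ge (i + r) x hi (by
    intro j hj
    have := hx (Sum.inl ⟨j - (i + r + 1), by omega⟩)
    simp only [c, Sum.elim_inl] at this
    rw [← this]
    congr 2
    ext
    change (j : ℕ) = i + r + 1 + (j - (i + r + 1))
    omega)
  have h2 := hB.le i x (by
    intro j hj
    exact hx (Sum.inr (Sum.inl ⟨j, hj⟩)))
  have h3 := hq x (fun k => hx (Sum.inr (Sum.inr k)))
  have := dot_pos hx0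
  exact le_of_mul_le_mul_right (h1.trans (h3.trans h2)) this

lemma range_map_eq (n : ℕ) (a : ℕ → ℝ) : (Multiset.range n).map a =
    (Finset.univ : Finset (Fin n)).val.map (fun i : Fin n => a i) := by
  rw [← Finset.range_val, ← Nat.Iio_eq_range, ← Fin.map_valEmbedding_univ]
  rw [Finset.map_val, Multiset.map_map]
  rfl

lemma exists_perm_of_map_eq {n : ℕ} {f g : Fin n → ℝ}
    (h : (Finset.univ : Finset (Fin n)).val.map f = (Finset.univ : Finset (Fin n)).val.map g) :
    ∃ σ : Fin n ≃ Fin n, f = g ∘ σ := by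
  classical
  have hc : ∀ c : ℝ, Nonempty ({i // f i = c} ≃ {i // g i = c}) := by
    intro c
    refine ⟨Fintype.equivOfCardEq ?_⟩
    have := congrArg (Multiset.count c) h
    rw [Multiset.count_map, Multiset.count_map] at this
    rw [Fintype.card_subtype, Fintype.card_subtype]
    simp only [eq_comm (a := c)] at this
    exact this
  refine ⟨Equiv.ofFiberEquiv fun c => (hc c).some, ?_⟩
  funext i
  exact (Equiv.ofFiberEquiv_map _ i).symm

lemma SD.of_roots {n : ℕ} {A : Matrix (Fin n) (Fin n) ℝ} (hA : A.IsHermitian) (a : ℕ → ℝ)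
    (anti : ∀ i j, i ≤ j → j < n → a j ≤ a i)
    (hr : A.charpoly.roots = (Multiset.range n).map a) : ∃ u, SD A a u := by
  have hr' : (Finset.univ : Finset (Fin n)).val.map hA.eigenvalues =
      (Finset.univ : Finset (Fin n)).val.map (fun i : Fin n => a i) := by
    have := hA.roots_charpoly_eq_eigenvalues
    rw [hr] at this
    have h2 : (Multiset.range n).map a =
        (Finset.univ : Finset (Fin n)).val.map (fun i : Fin n => a i) := by
      exact range_map_eq n a
    rw [← h2, this]
    rfl
  obtain ⟨σ, hσ⟩ := exists_perm_of_map_eq hr'.symm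
  have hip : ∀ x y : Fin n → ℝ, inner ℝ (WithLp.toLp 2 x) (WithLp.toLp 2 y) = x ⬝ᵥ y := by
    intro x y
    simp [EuclideanSpace.inner_eq_star_dotProduct, dotProduct_comm]
  have hpars : ∀ x y : Fin n → ℝ, x ⬝ᵥ y = ∑ i, ((hA.eigenvectorBasis i).ofLp ⬝ᵥ x) *
      ((hA.eigenvectorBasis i).ofLp ⬝ᵥ y) := by
    intro x y
    rw [← hip, ← hA.eigenvectorBasis.sum_inner_mul_inner]
    refine Finset.sum_congr rfl fun i _ => ?_
    rw [← hip, ← hip, real_inner_comm]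
  refine ⟨fun i => (hA.eigenvectorBasis (σ i)).ofLp, anti, ?_, ?_, ?_⟩
  · intro x
    rw [hpars, ← Equiv.sum_comp σ]
    simp [sq]
  · intro x
    rw [hpars, ← Equiv.sum_comp σ]
    refine Finset.sum_congr rfl fun i _ => ?_
    have h1 : (hA.eigenvectorBasis (σ i)).ofLp ⬝ᵥ (A *ᵥ x) =
        a i * ((hA.eigenvectorBasis (σ i)).ofLp ⬝ᵥ x) := by
      rw [dotProduct_mulVec, ← mulVec_transpose]
      have : Aᵀ = A := by simpa [Matrix.IsHermitian] using hA
      rw [this, hA.mulVec_eigenvectorBasis, smul_dotProduct, smul_eq_mul]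
      have := congrFun hσ i
      simp only [Function.comp] at this
      rw [this]
    rw [h1]; ring
  · rw [hA.trace_eq_sum_eigenvalues, ← Fin.sum_univ_eq_sum_range]
    simp only [RCLike.ofReal_real_eq_id, id]
    rw [← Equiv.sum_comp σ]
    exact Finset.sum_congr rfl fun i _ => (congrFun hσ i).symm

lemma SD.exist {n : ℕ} {A : Matrix (Fin n) (Fin n) ℝ} (hA : A.IsHermitian) :
    ∃ a u, SD A a u ∧ A.charpoly.roots = (Multiset.range n).map a := by
  let σ := Tuple.sort (fun i => - hA.eigenvalues i)
  have hm := Tuple.monotone_sort (fun i => - hA.eigenvalues i)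
  let a : ℕ → ℝ := fun i => if h : i < n then hA.eigenvalues (σ ⟨i, h⟩) else 0
  have hr : A.charpoly.roots = (Multiset.range n).map a := by
    have h2 : (Multiset.range n).map a =
        (Finset.univ : Finset (Fin n)).val.map (fun i : Fin n => a i) := by
      exact range_map_eq n a
    rw [h2, hA.roots_charpoly_eq_eigenvalues]
    have h3 : (fun i : Fin n => a i) = hA.eigenvalues ∘ σ := by
      funext i
      simp [a]
    rw [h3, ← Multiset.map_map hA.eigenvalues σ, Multiset.map_univ_val_equiv]
    rfl
  obtain ⟨u, hu⟩ := SD.of_roots hA a (by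
    intro i j hij hj
    have := @hm ⟨i, by omega⟩ ⟨j, hj⟩ hij
    simp only [a, hj, dif_pos, (by omega : i < n)]
    simp only [Function.comp] at this
    exact neg_le_neg_iff.1 this) hr
  exact ⟨a, u, hu, hr⟩

lemma SD.neg {n : ℕ} {A : Matrix (Fin n) (Fin n) ℝ} {a : ℕ → ℝ} {u} (h : SD A a u) :
    SD (-A) (fun i => - a (n - 1 - i)) (fun i => u i.rev) where
  anti i j hij hj := neg_le_neg (h.anti _ _ (by omega) (by omega))
  nrm x := by
    rw [h.nrm, ← Equiv.sum_comp Fin.revPerm]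
    rfl
  quad x := by
    rw [neg_mulVec, dotProduct_neg, h.quad, ← Equiv.sum_comp Fin.revPerm, ← Finset.sum_neg_distrib]
    refine Finset.sum_congr rfl fun i _ => ?_
    simp only [Fin.revPerm_apply, Fin.val_rev]
    rw [show n - (↑i + 1) = n - 1 - i by omega]
    ring
  tr := by
    rw [trace_neg, h.tr, Finset.sum_neg_distrib, Finset.sum_range_reflect]

lemma SD.main {n : ℕ} {A B : Matrix (Fin n) (Fin n) ℝ} {a b : ℕ → ℝ} {u v}
    (hAh : A.IsHermitian) (hA : SD A a u) (hB : SD B b v) (w : Fin n → ℝ) (hw : w ⬝ᵥ w = 1)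
    (hq : ∀ x, x ⬝ᵥ (A *ᵥ x) - (w ⬝ᵥ x) ^ 2 ≤ x ⬝ᵥ (B *ᵥ x)) (k : ℕ) (hk : k < n) :
    ∑ i ∈ Finset.Ico k n, fpos (a i) - fpos (a k) + fpos (a k - 1) ≤
      ∑ i ∈ Finset.Ico k n, fpos (b i) := by
  have hMh : (A - vecMulVec w w).IsHermitian := by
    refine hAh.sub ?_
    ext i j
    simp [vecMulVec_apply, mul_comm]
  obtain ⟨m, z, hM, -⟩ := SD.exist hMh
  have hMq : ∀ x, x ⬝ᵥ ((A - vecMulVec w w) *ᵥ x) = x ⬝ᵥ (A *ᵥ x) - (w ⬝ᵥ x) ^ 2 := by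
    intro x
    rw [sub_mulVec, dotProduct_sub, vecMulVec_mulVec]
    simp [dotProduct_comm, sq]
  refine real_main a m b k n hk ?_ ?_ ?_ ?_
  · intro i hi
    refine interlace hM hA 0 (fun _ => 0) (fun x _ => ?_) i hi
    rw [hMq]
    linarith [sq_nonneg (w ⬝ᵥ x)]
  · intro i hi
    refine interlace hA hM 1 (fun _ => w) (fun x hx => ?_) i hi
    rw [hMq, hx 0]
    simp
  · intro i hi
    refine interlace hM hB 0 (fun _ => 0) (fun x _ => ?_) i hi
    rw [hMq]
    exact hq x
  · rw [← hM.tr, ← hA.tr, trace_sub, trace_vecMulVec, hw]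

lemma sPlus_eq {n : ℕ} (G : SimpleGraph (Fin n)) (a : ℕ → ℝ)
    (h : (adjMat G).charpoly.roots = (Multiset.range n).map a) :
    sPlus G = ∑ i ∈ Finset.range n, fpos (a i) := by
  have key : ∀ s : Multiset ℝ, ((s.filter (fun x : ℝ => 0 < x)).map (fun x : ℝ => x ^ 2)).sum =
      (s.map fpos).sum := by
    intro s
    induction s using Multiset.induction with
    | empty => simp
    | cons x s ih =>
      by_cases hx : 0 < x
      · simp [hx, ih, fpos, hx.le]
      · simp [hx, ih, fpos, not_lt.1 hx]
  rw [sPlus, key, h, Multiset.map_map]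
  rfl

lemma sMinus_eq {n : ℕ} (G : SimpleGraph (Fin n)) (a : ℕ → ℝ)
    (h : (adjMat G).charpoly.roots = (Multiset.range n).map a) :
    sMinus G = ∑ i ∈ Finset.range n, fpos (-a (n - 1 - i)) := by
  have key : ∀ s : Multiset ℝ, ((s.filter (fun x : ℝ => x < 0)).map (fun x : ℝ => x ^ 2)).sum =
      (s.map (fun x => fpos (-x))).sum := by
    intro s
    induction s using Multiset.induction with
    | empty => simp
    | cons x s ih =>
      by_cases hx : x < 0
      · simp [hx, ih, fpos, hx.le]
      · simp [hx, ih, fpos, not_lt.1 hx]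
  rw [sMinus, key, h, Multiset.map_map, Finset.sum_range_reflect (fun i => fpos (- a i))]
  rfl

lemma adjMat_herm {n : ℕ} (G : SimpleGraph (Fin n)) : (adjMat G).IsHermitian := by
  classical
  unfold adjMat
  ext i j
  simp [SimpleGraph.adjMatrix_apply, SimpleGraph.adj_comm]

lemma adjMat_del {n : ℕ} (G : SimpleGraph (Fin n)) (p q : Fin n) (h : G.Adj p q) :
    adjMat G = adjMat (G.deleteEdges {s(p, q)}) + Matrix.single p q 1 + Matrix.single q p 1 := by
  classical
  have hne := h.ne
  unfold adjMat
  ext i j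
  simp only [SimpleGraph.adjMatrix_apply, Matrix.add_apply, Matrix.single_apply,
    SimpleGraph.deleteEdges_adj, Set.mem_singleton_iff, Sym2.eq_iff]
  by_cases h1 : p = i ∧ q = j
  · obtain ⟨rfl, rfl⟩ := h1
    simp [h, hne, hne.symm]
  · by_cases h2 : q = i ∧ p = j
    · obtain ⟨rfl, rfl⟩ := h2
      simp [h.symm, hne, hne.symm]
    · have h1' : ¬ (i = p ∧ j = q) := fun h => h1 ⟨h.1.symm, h.2.symm⟩
      have h2' : ¬ (i = q ∧ j = p) := fun h => h2 ⟨h.1.symm, h.2.symm⟩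
      simp [h1, h2, h1', h2']

lemma quad_del {n : ℕ} (G : SimpleGraph (Fin n)) (p q : Fin n) (h : G.Adj p q) (x : Fin n → ℝ) :
    x ⬝ᵥ (adjMat G *ᵥ x) = x ⬝ᵥ (adjMat (G.deleteEdges {s(p, q)}) *ᵥ x) + 2 * x p * x q := by
  rw [adjMat_del G p q h, add_mulVec, add_mulVec, dotProduct_add, dotProduct_add,
    single_mulVec, single_mulVec]
  simp [dotProduct, Function.update_apply]
  ring

lemma quad_abs {n : ℕ} (G : SimpleGraph (Fin n)) (x : Fin n → ℝ) :
    x ⬝ᵥ (adjMat G *ᵥ x) ≤ (fun i => |x i|) ⬝ᵥ (adjMat G *ᵥ (fun i => |x i|)) := by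
  classical
  simp only [dotProduct, mulVec, Finset.mul_sum]
  refine Finset.sum_le_sum fun i _ => Finset.sum_le_sum fun j _ => ?_
  have h0 : 0 ≤ adjMat G i j := by
    unfold adjMat
    rw [SimpleGraph.adjMatrix_apply]
    split_ifs <;> norm_num
  have : x i * x j ≤ |x i| * |x j| := by
    rw [← abs_mul]; exact le_abs_self _
  nlinarith [mul_le_mul_of_nonneg_left this h0]

lemma perron {n : ℕ} (G : SimpleGraph (Fin n)) (p q : Fin n) (h : G.Adj p q)
    {a b : ℕ → ℝ} {u v} (hA : SD (adjMat (G.deleteEdges {s(p, q)})) a u)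
    (hB : SD (adjMat G) b v) : a 0 ≤ b 0 := by
  have hn : 0 < n := p.pos
  obtain ⟨x, hx0, hx⟩ := exists_ker (fun j : Fin (n - 1) => u ⟨j + 1, by omega⟩) (by simp; omega)
  have h1 := hA.ge 0 x hn (by
    intro j hj
    have := hx ⟨j - 1, by omega⟩
    rw [← this]
    congr 2
    ext
    change (j : ℕ) = j - 1 + 1
    omega)
  have h2 := quad_abs (G.deleteEdges {s(p, q)}) x
  have h3 := quad_del G p q h (fun i => |x i|)
  have h4 := hB.le 0 (fun i => |x i|) (by simp)
  have h5 : (fun i => |x i|) ⬝ᵥ (fun i => |x i|) = x ⬝ᵥ x := by simp [dotProduct]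
  rw [h5] at h4
  have h6 : 0 ≤ 2 * |x p| * |x q| := by positivity
  refine le_of_mul_le_mul_right ?_ (dot_pos hx0)
  linarith

/-- the vector `(e_p + s e_q)/√2` -/
noncomputable def wvec {n : ℕ} (p q : Fin n) (s : ℝ) : Fin n → ℝ :=
  (√2)⁻¹ • (Pi.single p 1 + s • Pi.single q 1)

lemma wvec_dot {n : ℕ} (p q : Fin n) (s : ℝ) (x : Fin n → ℝ) :
    wvec p q s ⬝ᵥ x = (√2)⁻¹ * (x p + s * x q) := by
  simp [wvec, smul_dotProduct, add_dotProduct]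
  ring

lemma sqrt_two_inv_sq : ((√2)⁻¹ : ℝ) ^ 2 = 1 / 2 := by
  rw [inv_pow, Real.sq_sqrt (by norm_num)]; norm_num

lemma wvec_self {n : ℕ} (p q : Fin n) (h : p ≠ q) (s : ℝ) (hs : s ^ 2 = 1) :
    wvec p q s ⬝ᵥ wvec p q s = 1 := by
  rw [wvec_dot]
  simp [wvec, h, h.symm]
  have := sqrt_two_inv_sq
  have h2 : (√2)⁻¹ * ((√2)⁻¹ + s * ((√2)⁻¹ * s)) = ((√2)⁻¹ : ℝ) ^ 2 * (1 + s ^ 2) := by ring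
  rw [h2, this, hs]; norm_num

/-- Let `G` be a simple graph on `n` vertices, `e ∈ E(G)`, `H = G - e`,
with `θ` the nonincreasing list of eigenvalues of `A(H)` (0-indexed, so `θ 1 = θ₂` and
`θ (n-1) = θₙ`); `H` has at least two positive (`0 < θ 1`) and at least two negative
(`θ (n-2) < 0`) eigenvalues. If `s⁺(H) + max{θ₂ - 1, 0}² - θ₂² ≥ n - 1` and
`s⁻(H) + max{-θₙ - 1, 0}² - θₙ² ≥ n - 1`, then `min{s⁺(G), s⁻(G)} ≥ n - 1`. -/
theorem min_square_energies_edge_deletion {n : ℕ}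
    (G H : SimpleGraph (Fin n)) (e : Sym2 (Fin n)) (he : e ∈ G.edgeSet)
    (hH : H = G.deleteEdges {e})
    (θ : ℕ → ℝ) (hθ_mono : Antitone θ)
    (hθ : (adjMat H).charpoly.roots = (Multiset.range n).map θ)
    (hn : 2 ≤ n) (hpos : 0 < θ 1) (hneg : θ (n - 2) < 0)
    (h1 : sPlus H + max (θ 1 - 1) 0 ^ 2 - θ 1 ^ 2 ≥ (n : ℝ) - 1)
    (h2 : sMinus H + max (-θ (n - 1) - 1) 0 ^ 2 - θ (n - 1) ^ 2 ≥ (n : ℝ) - 1) :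
    min (sPlus G) (sMinus G) ≥ (n : ℝ) - 1 := by
  induction e using Sym2.ind with
  | _ p q =>
  have hadj : G.Adj p q := he
  subst hH
  obtain ⟨u, hA⟩ := SD.of_roots (adjMat_herm _) θ (fun i j hij _ => hθ_mono hij) hθ
  obtain ⟨b, v, hB, hb⟩ := SD.exist (adjMat_herm G)
  have hq := quad_del G p q hadj
  have hθn : θ (n - 1) < 0 := (hθ_mono (by omega)).trans_lt hneg
  rw [ge_iff_le, le_min_iff]
  constructor
  · have m := SD.main (adjMat_herm _) hA hB (wvec p q (-1)) (wvec_self p q hadj.ne _ (by norm_num))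
      (by
        intro x
        rw [wvec_dot, mul_pow, sqrt_two_inv_sq, hq]
        nlinarith [sq_nonneg (x p + x q)]) 1 (by omega)
    have hp := fpos_mono (perron G p q hadj hA hB)
    rw [sPlus_eq _ _ hθ, Finset.range_eq_Ico, Finset.sum_eq_sum_Ico_succ_bot (by omega)] at h1
    rw [sPlus_eq _ _ hb, Finset.range_eq_Ico, Finset.sum_eq_sum_Ico_succ_bot (by omega)]
    have e1 : fpos (θ 1) = θ 1 ^ 2 := by simp [fpos, hpos.le]
    have e2 : fpos (θ 1 - 1) = max (θ 1 - 1) 0 ^ 2 := rfl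
    simp only [zero_add] at h1 ⊢
    linarith
  · have m := SD.main (adjMat_herm _).neg hA.neg hB.neg (wvec p q 1)
      (wvec_self p q hadj.ne _ (by norm_num))
      (by
        intro x
        rw [wvec_dot, mul_pow, sqrt_two_inv_sq, neg_mulVec, neg_mulVec, dotProduct_neg,
          dotProduct_neg, hq]
        nlinarith [sq_nonneg (x p - x q)]) 0 (by omega)
    rw [sMinus_eq _ _ hθ, Finset.range_eq_Ico] at h2
    rw [sMinus_eq _ _ hb, Finset.range_eq_Ico]
    have e1 : fpos (-θ (n - 1)) = θ (n - 1) ^ 2 := by simp [fpos, hθn.le]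
    have e2 : fpos (-θ (n - 1) - 1) = max (-θ (n - 1) - 1) 0 ^ 2 := rfl
    simp only [Nat.sub_zero] at m
    linarith
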